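/- arXiv:1612.03693 — 7 statements merged into one kernel-verified Lean document; each statement's English description precedes it below -/
import Mathlib

section
/- Let K be a totally real number field of degree n over ℚ, let σ_1, …, σ_n : K → ℝ be its n real embeddings, and let e_1, …, e_n ∈ O_K satisfy σ_j(e_i) > 0 for all i, j. For a ∈ (ℕ≥1)^n write α_a = a_1 e_1 + ⋯ + a_n e_n and N(α_a) = ∏_{j} σ_j(α_a). Then ∫_{u ∈ (0,∞)^n} ( ∫_{t ∈ ∏_j (u_j,∞)} ∑_{a ∈ (ℕ≥1)^n} exp(−∑_{j} t_j σ_j(α_a)) dt ) du = ∑_{a ∈ (ℕ≥1)^n} N(α_a)^{−2}, where both iterated integrals of the nonnegative integrand and the series on the right converge. -/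
open scoped NumberField
open MeasureTheory

lemma zaux_summable_pi {n : ℕ} (f : Fin n → ℕ → ℝ) (h0 : ∀ j m, 0 ≤ f j m)
    (hs : ∀ j, Summable (f j)) : Summable (fun a : Fin n → ℕ => ∏ j, f j (a j)) := by
  classical
  refine summable_of_sum_le (c := ∏ j, ∑' m, f j m)
    (fun a => Finset.prod_nonneg fun j _ => h0 j _) ?_
  intro u
  calc ∑ a ∈ u, ∏ j, f j (a j)
      ≤ ∑ a ∈ Fintype.piFinset (fun j => u.image (fun a => a j)), ∏ j, f j (a j) := by
        refine Finset.sum_le_sum_of_subset_of_nonneg ?_ ?_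
        · intro a ha
          simp only [Fintype.mem_piFinset, Finset.mem_image]
          exact fun j => ⟨a, ha, rfl⟩
        · intro a _ _
          exact Finset.prod_nonneg fun j _ => h0 j _
    _ = ∏ j, ∑ m ∈ u.image (fun a => a j), f j m := by
        rw [Finset.prod_univ_sum]
    _ ≤ ∏ j, ∑' m, f j m := by
        refine Finset.prod_le_prod (fun j _ => Finset.sum_nonneg fun m _ => h0 j m) ?_
        intro j _
        exact (hs j).sum_le_tsum _ (fun m _ => h0 j m)

lemma zaux_lintegral {n : ℕ} (s u : Fin n → ℝ) (hs : ∀ j, 0 < s j) :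
    ∫⁻ t in Set.pi Set.univ (fun j : Fin n => Set.Ioi (u j)),
      ENNReal.ofReal (Real.exp (-(∑ j, t j * s j)))
    = ENNReal.ofReal (Real.exp (-(∑ j, u j * s j))) * ENNReal.ofReal (∏ j, s j)⁻¹ := by
  have hfun : ∀ t : Fin n → ℝ, Real.exp (-(∑ j, t j * s j))
      = ∏ j, Real.exp (-s j * t j) := by
    intro t
    rw [← Real.exp_sum, ← Finset.sum_neg_distrib]
    congr 1
    exact Finset.sum_congr rfl fun j _ => by ring
  simp_rw [hfun]
  rw [volume_pi, Measure.restrict_pi_pi]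
  have hint : Integrable (fun t : Fin n → ℝ => ∏ j, Real.exp (-s j * t j))
      (Measure.pi fun j => (volume : Measure ℝ).restrict (Set.Ioi (u j))) :=
    Integrable.fintype_prod (f := fun j x => Real.exp (-s j * x))
      (fun j => integrableOn_exp_mul_Ioi (by simpa using hs j) (u j))
  rw [← ofReal_integral_eq_lintegral_ofReal hint
    (Filter.Eventually.of_forall fun t => Finset.prod_nonneg fun j _ => (Real.exp_pos _).le)]
  rw [integral_fintype_prod_eq_prod (f := fun j x => Real.exp (-s j * x)),
    ← ENNReal.ofReal_mul (Finset.prod_nonneg fun j _ => (Real.exp_pos _).le),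
    ← Finset.prod_inv_distrib, ← Finset.prod_mul_distrib]
  congr 1
  refine Finset.prod_congr rfl fun j _ => ?_
  rw [integral_exp_mul_Ioi (by simpa using hs j), neg_div_neg_eq, div_eq_mul_inv]

lemma zaux_main {n : ℕ} (s : {a : Fin n → ℕ // ∀ i, 1 ≤ a i} → Fin n → ℝ)
    (c : Fin n → ℝ) (hc : ∀ j, 0 < c j) (hs : ∀ a j, c j * (a.1 j : ℝ) ≤ s a j) :
    Summable (fun a => ((∏ j, s a j) ^ 2)⁻¹) ∧
    ∫⁻ u in Set.pi Set.univ (fun _ : Fin n => Set.Ioi (0 : ℝ)),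
      ∫⁻ t in Set.pi Set.univ (fun j : Fin n => Set.Ioi (u j)),
        ENNReal.ofReal (∑' a, Real.exp (-(∑ j, t j * s a j)))
      = ENNReal.ofReal (∑' a, ((∏ j, s a j) ^ 2)⁻¹) := by
  have hca : ∀ (a : {a : Fin n → ℕ // ∀ i, 1 ≤ a i}) j, 0 < c j * (a.1 j : ℝ) := fun a j =>
    mul_pos (hc j) (by exact_mod_cast a.2 j)
  have hpos : ∀ a j, 0 < s a j := fun a j => (hca a j).trans_le (hs a j)
  have hsum : Summable (fun a => ((∏ j, s a j) ^ 2)⁻¹) := by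
    have h1 := zaux_summable_pi (fun (j : Fin n) (m : ℕ) => ((c j * (m : ℝ)) ^ 2)⁻¹)
      (fun j m => by positivity) (fun j => by
        simp_rw [mul_pow, mul_inv]
        exact (Real.summable_nat_pow_inv.2 one_lt_two).mul_left _)
    refine Summable.of_nonneg_of_le (fun a => by positivity) (fun a => ?_)
      (h1.comp_injective Subtype.val_injective)
    simp only [Function.comp]
    rw [← Finset.prod_pow, ← Finset.prod_inv_distrib]
    refine Finset.prod_le_prod (fun j _ => by positivity) fun j _ => ?_
    have := hca a j
    gcongr
    exact hs a j
  refine ⟨hsum, ?_⟩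
  have hexp : ∀ t : Fin n → ℝ, (∀ j, 0 < t j) →
      Summable (fun a => Real.exp (-(∑ j, t j * s a j))) := by
    intro t ht
    have h1 := zaux_summable_pi (fun (j : Fin n) (m : ℕ) => Real.exp (m * (-(t j * c j))))
      (fun j m => (Real.exp_pos _).le) (fun j =>
        Real.summable_exp_nat_mul_iff.2 (neg_lt_zero.2 (mul_pos (ht j) (hc j))))
    refine Summable.of_nonneg_of_le (fun a => (Real.exp_pos _).le) (fun a => ?_)
      (h1.comp_injective Subtype.val_injective)
    simp only [Function.comp]
    rw [← Real.exp_sum, ← Finset.sum_neg_distrib]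
    refine Real.exp_le_exp.2 (Finset.sum_le_sum fun j _ => ?_)
    nlinarith [mul_le_mul_of_nonneg_left (hs a j) (ht j).le]
  have hms : ∀ u : Fin n → ℝ, MeasurableSet (Set.pi Set.univ (fun j => Set.Ioi (u j))) :=
    fun u => MeasurableSet.univ_pi fun j => measurableSet_Ioi
  have hmeas : ∀ a, Measurable fun t : Fin n → ℝ =>
      ENNReal.ofReal (Real.exp (-(∑ j, t j * s a j))) := fun a => by fun_prop
  have hinner : ∀ u ∈ Set.pi Set.univ (fun _ : Fin n => Set.Ioi (0 : ℝ)),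
      ∫⁻ t in Set.pi Set.univ (fun j : Fin n => Set.Ioi (u j)),
        ENNReal.ofReal (∑' a, Real.exp (-(∑ j, t j * s a j)))
      = ∑' a, ENNReal.ofReal (Real.exp (-(∑ j, u j * s a j))) *
          ENNReal.ofReal (∏ j, s a j)⁻¹ := by
    intro u hu
    rw [setLIntegral_congr_fun (hms u)
      (g := fun t => ∑' a, ENNReal.ofReal (Real.exp (-(∑ j, t j * s a j)))),
      lintegral_tsum fun a => (hmeas a).aemeasurable]
    · exact tsum_congr fun a => zaux_lintegral (s a) u (hpos a)
    · intro t ht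
      exact ENNReal.ofReal_tsum_of_nonneg (fun a => (Real.exp_pos _).le)
        (hexp t fun j => lt_trans (hu j trivial) (ht j trivial))
  rw [setLIntegral_congr_fun (hms fun _ => 0) hinner,
    lintegral_tsum fun a => ((hmeas a).mul_const _).aemeasurable,
    ENNReal.ofReal_tsum_of_nonneg (fun a => by positivity) hsum]
  refine tsum_congr fun a => ?_
  rw [lintegral_mul_const _ (hmeas a), zaux_lintegral (s a) (fun _ => 0) (hpos a)]
  have h0 : 0 ≤ (∏ j, s a j)⁻¹ := inv_nonneg.2 (Finset.prod_nonneg fun j _ => (hpos a j).le)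
  simp only [zero_mul, Finset.sum_const_zero, neg_zero, Real.exp_zero, ENNReal.ofReal_one, one_mul]
  rw [← ENNReal.ofReal_mul h0, ← mul_inv, sq]

/-- ζ_{K;C}(2) as an iterated integral on a membrane: for a totally real number
field `K` of degree `n` with real embeddings `σ j` and totally positive
algebraic integers `e i`, with `α_a = ∑ i, a i • e i` for tuples `a` of positive
integers,
`∫_{u∈(0,∞)ⁿ} ∫_{t∈∏(uⱼ,∞)} ∑_a exp(−∑ⱼ tⱼ σⱼ(α_a)) dt du = ∑_a N(α_a)⁻²`,
where the series on the right converges. -/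
theorem zeta2_iterated_integral (K : Type*) [Field K] [NumberField K]
    (n : ℕ) (hn : n = Module.finrank ℚ K)
    (σ : Fin n ≃ (K →+* ℝ))
    (e : Fin n → 𝓞 K)
    (he : ∀ i j, 0 < σ j (e i : K)) :
    Summable
      (fun a : {a : Fin n → ℕ // ∀ i, 1 ≤ a i} =>
        ((∏ j, σ j (∑ i, (a.1 i : K) * (e i : K))) ^ 2)⁻¹) ∧
    ∫⁻ u in Set.pi Set.univ (fun _ : Fin n => Set.Ioi (0 : ℝ)),
      ∫⁻ t in Set.pi Set.univ (fun j : Fin n => Set.Ioi (u j)),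
        ENNReal.ofReal
          (∑' a : {a : Fin n → ℕ // ∀ i, 1 ≤ a i},
            Real.exp (-(∑ j, t j * σ j (∑ i, (a.1 i : K) * (e i : K)))))
      = ENNReal.ofReal
          (∑' a : {a : Fin n → ℕ // ∀ i, 1 ≤ a i},
            ((∏ j, σ j (∑ i, (a.1 i : K) * (e i : K))) ^ 2)⁻¹) := by
  refine zaux_main (fun a j => σ j (∑ i, (a.1 i : K) * (e i : K))) (fun j => σ j (e j : K))
    (fun j => he j j) ?_
  intro a j
  simp only [map_sum, map_mul, map_natCast]
  rw [mul_comm]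
  exact Finset.single_le_sum (f := fun i => (a.1 i : ℝ) * σ j (e i : K))
    (fun i _ => mul_nonneg (Nat.cast_nonneg _) (he i j).le) (Finset.mem_univ j)
end

section
/- Let K be a totally real number field of degree n over ℚ, let σ_1, …, σ_n : K → ℝ be its n real embeddings, and let e_1, …, e_n ∈ O_K satisfy σ_j(e_i) > 0 for all i, j. For a ∈ (ℕ≥1)^n write α_a = a_1 e_1 + ⋯ + a_n e_n and N(α_a) = ∏_{j} σ_j(α_a). Then ∫_{v ∈ (0,∞)^n} ( ∫_{u ∈ ∏_j (v_j,∞)} ( ∫_{t ∈ ∏_j (u_j,∞)} ∑_{a ∈ (ℕ≥1)^n} exp(−∑_{j} t_j σ_j(α_a)) dt ) du ) dv = ∑_{a ∈ (ℕ≥1)^n} N(α_a)^{−3}, where all iterated integrals of the nonnegative integrand and the series on the right converge. -/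
open scoped NumberField
open MeasureTheory

theorem aux_summable_prod : ∀ (n : ℕ) (f : Fin n → ℕ → ℝ), (∀ i k, 0 ≤ f i k) →
    (∀ i, Summable (f i)) → Summable (fun a : Fin n → ℕ => ∏ i, f i (a i)) := by
  intro n
  induction n with
  | zero => intro f _ _; exact Summable.of_finite
  | succ n ih =>
    intro f hf hs
    have h := Summable.mul_of_nonneg (hs 0)
      (ih (fun i => f i.succ) (fun i k => hf _ _) (fun i => hs _)) (fun k => hf 0 k)
      (fun a => Finset.prod_nonneg (fun i _ => hf _ _))
    rw [← (Fin.consEquiv (fun _ : Fin (n+1) => ℕ)).summable_iff]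
    refine h.congr (fun x => ?_)
    simp [Fin.prod_univ_succ, Fin.consEquiv]

theorem aux_lintegral (n : ℕ) (A : Fin n → ℝ) (hA : ∀ j, 0 < A j) (w : Fin n → ℝ) :
    ∫⁻ t in Set.pi Set.univ (fun j : Fin n => Set.Ioi (w j)),
      ENNReal.ofReal (Real.exp (-(∑ j, t j * A j)))
    = ENNReal.ofReal (∏ j, A j)⁻¹ * ENNReal.ofReal (Real.exp (-(∑ j, w j * A j))) := by
  have hexp : ∀ t : Fin n → ℝ, Real.exp (-(∑ j, t j * A j)) = ∏ j, Real.exp (-A j * t j) := by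
    intro t
    rw [← Real.exp_sum, ← Finset.sum_neg_distrib]
    congr 1
    exact Finset.sum_congr rfl (fun j _ => by ring)
  simp_rw [hexp]
  rw [volume_pi, Measure.restrict_pi_pi, ← ofReal_integral_eq_lintegral_ofReal]
  · rw [integral_fintype_prod_eq_prod (fun j x => Real.exp (-A j * x)), ← ENNReal.ofReal_mul,
      ← Finset.prod_inv_distrib, ← Finset.prod_mul_distrib]
    · congr 1
      refine Finset.prod_congr rfl (fun j _ => ?_)
      rw [integral_exp_mul_Ioi (by linarith [hA j])]
      have := (hA j).ne'
      field_simp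
    · exact inv_nonneg.2 (Finset.prod_nonneg (fun j _ => (hA j).le))
  · exact Integrable.fintype_prod (f := fun j x => Real.exp (-A j * x))
      (fun j => integrableOn_exp_mul_Ioi (by linarith [hA j]) _)
  · exact Filter.Eventually.of_forall
      (fun t => Finset.prod_nonneg (fun j _ => (Real.exp_pos _).le))

theorem aux_main (n : ℕ) {ι : Type*} [Countable ι] (A : ι → Fin n → ℝ)
    (hA : ∀ a j, 0 < A a j)
    (hs : Summable (fun a => ((∏ j, A a j) ^ 3)⁻¹))
    (hs2 : ∀ t : Fin n → ℝ, (∀ j, 0 < t j) →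
      Summable (fun a => Real.exp (-(∑ j, t j * A a j)))) :
    ∫⁻ v in Set.pi Set.univ (fun _ : Fin n => Set.Ioi (0 : ℝ)),
      ∫⁻ u in Set.pi Set.univ (fun j : Fin n => Set.Ioi (v j)),
        ∫⁻ t in Set.pi Set.univ (fun j : Fin n => Set.Ioi (u j)),
          ENNReal.ofReal (∑' a, Real.exp (-(∑ j, t j * A a j)))
      = ENNReal.ofReal (∑' a, ((∏ j, A a j) ^ 3)⁻¹) := by
  have hms : ∀ w : Fin n → ℝ, MeasurableSet (Set.pi Set.univ (fun j : Fin n => Set.Ioi (w j))) :=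
    fun w => MeasurableSet.univ_pi (fun _ => measurableSet_Ioi)
  have hmeas : ∀ a, Measurable (fun t : Fin n → ℝ =>
      ENNReal.ofReal (Real.exp (-(∑ j, t j * A a j)))) := by
    intro a; fun_prop
  have key : ∀ (c : ι → ENNReal) (w : Fin n → ℝ),
      ∫⁻ t in Set.pi Set.univ (fun j : Fin n => Set.Ioi (w j)),
        ∑' a, c a * ENNReal.ofReal (Real.exp (-(∑ j, t j * A a j)))
      = ∑' a, (c a * ENNReal.ofReal (∏ j, A a j)⁻¹) *
          ENNReal.ofReal (Real.exp (-(∑ j, w j * A a j))) := by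
    intro c w
    rw [lintegral_tsum (fun a => ((hmeas a).const_mul _).aemeasurable)]
    refine tsum_congr (fun a => ?_)
    rw [lintegral_const_mul _ (hmeas a), aux_lintegral n (A a) (hA a), mul_assoc]
  have h1 : ∀ u : Fin n → ℝ, (∀ j, 0 < u j) →
      ∫⁻ t in Set.pi Set.univ (fun j : Fin n => Set.Ioi (u j)),
          ENNReal.ofReal (∑' a, Real.exp (-(∑ j, t j * A a j)))
      = ∑' a, (1 * ENNReal.ofReal (∏ j, A a j)⁻¹) *
          ENNReal.ofReal (Real.exp (-(∑ j, u j * A a j))) := by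
    intro u hu
    rw [← key]
    refine setLIntegral_congr_fun (hms u) (fun t ht => ?_)
    have ht' : ∀ j, u j < t j := fun j => ht j (Set.mem_univ j)
    simp only [one_mul]
    exact ENNReal.ofReal_tsum_of_nonneg (fun a => (Real.exp_pos _).le)
      (hs2 t (fun j => (hu j).trans (ht' j)))
  have h2 : ∀ v : Fin n → ℝ, (∀ j, 0 < v j) →
      ∫⁻ u in Set.pi Set.univ (fun j : Fin n => Set.Ioi (v j)),
        ∫⁻ t in Set.pi Set.univ (fun j : Fin n => Set.Ioi (u j)),
          ENNReal.ofReal (∑' a, Real.exp (-(∑ j, t j * A a j)))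
      = ∑' a, (1 * ENNReal.ofReal (∏ j, A a j)⁻¹ * ENNReal.ofReal (∏ j, A a j)⁻¹) *
          ENNReal.ofReal (Real.exp (-(∑ j, v j * A a j))) := by
    intro v hv
    rw [← key]
    refine setLIntegral_congr_fun (hms v) (fun u hu => ?_)
    have hu' : ∀ j, v j < u j := fun j => hu j (Set.mem_univ j)
    exact h1 u (fun j => (hv j).trans (hu' j))
  rw [setLIntegral_congr_fun (hms (fun _ => 0)) (fun v hv => h2 v (fun j => hv j (Set.mem_univ j))),
    key, ENNReal.ofReal_tsum_of_nonneg _ hs]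
  · refine tsum_congr (fun a => ?_)
    have hp : 0 ≤ (∏ j, A a j)⁻¹ := inv_nonneg.2 (Finset.prod_nonneg (fun j _ => (hA a j).le))
    simp only [zero_mul, Finset.sum_const_zero, neg_zero, Real.exp_zero, ENNReal.ofReal_one,
      mul_one, one_mul]
    rw [← ENNReal.ofReal_mul hp, ← ENNReal.ofReal_mul (mul_nonneg hp hp), ← inv_pow]
    congr 1
    ring
  · intro a
    exact inv_nonneg.2 (pow_nonneg (Finset.prod_nonneg (fun j _ => (hA a j).le)) 3)

/-- ζ_{K;C}(3) as a triple iterated integral on a membrane: for a totally real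
number field `K` of degree `n` with real embeddings `σ j` and totally positive
algebraic integers `e i`, with `α_a = ∑ i, a i • e i` for tuples `a` of positive
integers,
`∫_{v∈(0,∞)ⁿ} ∫_{u∈∏(vⱼ,∞)} ∫_{t∈∏(uⱼ,∞)} ∑_a exp(−∑ⱼ tⱼ σⱼ(α_a)) dt du dv
  = ∑_a N(α_a)⁻³`,
where the series on the right converges. -/
theorem zeta3_iterated_integral (K : Type*) [Field K] [NumberField K]
    (n : ℕ) (hn : n = Module.finrank ℚ K)
    (σ : Fin n ≃ (K →+* ℝ))
    (e : Fin n → 𝓞 K)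
    (he : ∀ i j, 0 < σ j (e i : K)) :
    Summable
      (fun a : {a : Fin n → ℕ // ∀ i, 1 ≤ a i} =>
        ((∏ j, σ j (∑ i, (a.1 i : K) * (e i : K))) ^ 3)⁻¹) ∧
    ∫⁻ v in Set.pi Set.univ (fun _ : Fin n => Set.Ioi (0 : ℝ)),
      ∫⁻ u in Set.pi Set.univ (fun j : Fin n => Set.Ioi (v j)),
        ∫⁻ t in Set.pi Set.univ (fun j : Fin n => Set.Ioi (u j)),
          ENNReal.ofReal
            (∑' a : {a : Fin n → ℕ // ∀ i, 1 ≤ a i},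
              Real.exp (-(∑ j, t j * σ j (∑ i, (a.1 i : K) * (e i : K)))))
      = ENNReal.ofReal
          (∑' a : {a : Fin n → ℕ // ∀ i, 1 ≤ a i},
            ((∏ j, σ j (∑ i, (a.1 i : K) * (e i : K))) ^ 3)⁻¹) := by
  set A : {a : Fin n → ℕ // ∀ i, 1 ≤ a i} → Fin n → ℝ :=
    fun a j => σ j (∑ i, (a.1 i : K) * (e i : K)) with hAdef
  have hle : ∀ a j, (a.1 j : ℝ) * σ j (e j : K) ≤ A a j := by
    intro a j
    simp only [hAdef, map_sum, map_mul, map_natCast]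
    exact Finset.single_le_sum (f := fun i => (a.1 i : ℝ) * σ j (e i : K))
      (fun i _ => mul_nonneg (Nat.cast_nonneg _) (he i j).le) (Finset.mem_univ j)
  have hpos : ∀ (a : {a : Fin n → ℕ // ∀ i, 1 ≤ a i}) j, 0 < (a.1 j : ℝ) * σ j (e j : K) :=
    fun a j => mul_pos (by exact_mod_cast a.2 j) (he j j)
  have hA : ∀ a j, 0 < A a j := fun a j => (hpos a j).trans_le (hle a j)
  have hs : Summable (fun a => ((∏ j, A a j) ^ 3)⁻¹) := by
    have h := (aux_summable_prod n (fun j k => (((k : ℝ) * σ j (e j : K)) ^ 3)⁻¹)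
      (fun j k => inv_nonneg.2 (pow_nonneg (mul_nonneg (Nat.cast_nonneg _) (he j j).le) 3))
      (fun j => by
        simp_rw [mul_pow, mul_inv]
        exact (Real.summable_nat_pow_inv.2 (by norm_num)).mul_right _)).comp_injective
      (Subtype.val_injective (p := fun a : Fin n → ℕ => ∀ i, 1 ≤ a i))
    refine Summable.of_nonneg_of_le (fun a => ?_) (fun a => ?_) h
    · exact inv_nonneg.2 (pow_nonneg (Finset.prod_nonneg (fun j _ => (hA a j).le)) 3)
    · simp only [Function.comp]
      rw [← Finset.prod_pow, ← Finset.prod_inv_distrib]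
      refine Finset.prod_le_prod (fun j _ => inv_nonneg.2 (pow_nonneg (hA a j).le 3))
        (fun j _ => ?_)
      exact inv_anti₀ (pow_pos (hpos a j) 3) (pow_le_pow_left₀ (hpos a j).le (hle a j) 3)
  refine ⟨hs, aux_main n A hA hs (fun t ht => ?_)⟩
  have h := (aux_summable_prod n (fun j k => Real.exp ((k : ℝ) * -(t j * σ j (e j : K))))
    (fun j k => (Real.exp_pos _).le)
    (fun j => Real.summable_exp_nat_mul_iff.2
      (neg_lt_zero.2 (mul_pos (ht j) (he j j))))).comp_injective
    (Subtype.val_injective (p := fun a : Fin n → ℕ => ∀ i, 1 ≤ a i))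
  refine Summable.of_nonneg_of_le (fun a => (Real.exp_pos _).le) (fun a => ?_) h
  simp only [Function.comp]
  rw [← Real.exp_sum, ← Finset.sum_neg_distrib]
  refine Real.exp_le_exp.2 (Finset.sum_le_sum (fun j _ => ?_))
  have := mul_le_mul_of_nonneg_left (hle a j) (ht j).le
  linarith
end

section
/- Let K be a totally real number field of degree n over ℚ, let σ_1, …, σ_n : K → ℝ be its n real embeddings, and let e_1, …, e_n ∈ O_K satisfy σ_j(e_i) > 0 for all i, j. For a ∈ (ℕ≥1)^n write α_a = a_1 e_1 + ⋯ + a_n e_n and N(α) = ∏_{j} σ_j(α). Then ∫_{v ∈ (0,∞)^n} ( ∫_{u ∈ ∏_j (v_j,∞)} ( ∫_{t ∈ ∏_j (u_j,∞)} ∑_{a ∈ (ℕ≥1)^n} exp(−∑_{j} t_j σ_j(α_a)) dt ) · ( ∑_{b ∈ (ℕ≥1)^n} exp(−∑_{j} u_j σ_j(α_b)) ) du ) dv = ∑_{a, b ∈ (ℕ≥1)^n} N(α_a)^{−1} · N(α_a + α_b)^{−2}, where all iterated integrals of the nonnegative integrand and the series on the right converge. -/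
open scoped NumberField
open MeasureTheory

namespace Z12

lemma summable_pi_prod : ∀ (n : ℕ) (f : Fin n → ℕ → ℝ), (∀ i k, 0 ≤ f i k) →
    (∀ i, Summable (f i)) → Summable (fun a : Fin n → ℕ => ∏ i, f i (a i)) := by
  intro n
  induction n with
  | zero => intro f _ _; exact Summable.of_finite
  | succ n ih =>
    intro f h0 hs
    have h1 := ih (fun i => f i.succ) (fun i k => h0 _ k) (fun i => hs _)
    have h2 := (hs 0).mul_of_nonneg h1 (fun k => h0 0 k)
      (fun a => Finset.prod_nonneg (fun i _ => h0 _ _))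
    rw [← (Fin.consEquiv (fun _ : Fin (n+1) => ℕ)).summable_iff]
    refine h2.congr (fun p => ?_)
    simp [Fin.prod_univ_succ, Fin.consEquiv]

lemma lint_exp {n : ℕ} (x u : Fin n → ℝ) (hx : ∀ j, 0 < x j) :
    ∫⁻ t in Set.pi Set.univ (fun j : Fin n => Set.Ioi (u j)),
      ENNReal.ofReal (Real.exp (-(∑ j, t j * x j))) =
    ENNReal.ofReal ((∏ j, x j)⁻¹) * ENNReal.ofReal (Real.exp (-(∑ j, u j * x j))) := by
  have hfun : (fun t : Fin n → ℝ => Real.exp (-(∑ j, t j * x j))) =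
      fun t => ∏ j, Real.exp (-x j * t j) := by
    funext t
    rw [← Real.exp_sum, ← Finset.sum_neg_distrib]
    congr 1
    exact Finset.sum_congr rfl (fun j _ => by ring)
  have hint : Integrable (fun t : Fin n → ℝ => ∏ j, Real.exp (-x j * t j))
      (Measure.pi (fun j => (volume : Measure ℝ).restrict (Set.Ioi (u j)))) :=
    Integrable.fintype_prod (fun j => integrableOn_exp_mul_Ioi (by linarith [hx j]) (u j))
  rw [volume_pi, Measure.restrict_pi_pi, ← ofReal_integral_eq_lintegral_ofReal]
  · rw [hfun, integral_fintype_prod_eq_prod (fun j s => Real.exp (-x j * s)),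
      ← ENNReal.ofReal_mul (by exact inv_nonneg.2 (Finset.prod_nonneg fun j _ => (hx j).le)),
      congrFun hfun u, ← Finset.prod_inv_distrib, ← Finset.prod_mul_distrib]
    congr 1
    refine Finset.prod_congr rfl (fun j _ => ?_)
    rw [integral_exp_mul_Ioi (by linarith [hx j])]
    have := (hx j).ne'
    field_simp
  · rw [hfun]; exact hint
  · exact Filter.Eventually.of_forall (fun t => (Real.exp_pos _).le)

lemma tsum_mul_tsum' {ι : Type*} (f g : ι → ENNReal) :
    (∑' a, f a) * (∑' b, g b) = ∑' p : ι × ι, f p.1 * g p.2 := by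
  rw [ENNReal.tsum_prod (f := fun a b => f a * g b), ← ENNReal.tsum_mul_right]
  simp_rw [ENNReal.tsum_mul_left]

lemma meas_exp {n : ℕ} (x : Fin n → ℝ) :
    Measurable (fun t : Fin n → ℝ => ENNReal.ofReal (Real.exp (-(∑ j, t j * x j)))) := by
  fun_prop

lemma meas_pi {n : ℕ} (u : Fin n → ℝ) :
    MeasurableSet (Set.pi Set.univ (fun j : Fin n => Set.Ioi (u j))) :=
  MeasurableSet.univ_pi (fun _ => measurableSet_Ioi)

lemma main_int {n : ℕ} {ι : Type*} [Countable ι] (A : ι → Fin n → ℝ) (hA : ∀ a j, 0 < A a j)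
    (hs : ∀ t : Fin n → ℝ, (∀ j, 0 < t j) →
      Summable (fun a => Real.exp (-(∑ j, t j * A a j)))) :
    ∫⁻ v in Set.pi Set.univ (fun _ : Fin n => Set.Ioi (0 : ℝ)),
      ∫⁻ u in Set.pi Set.univ (fun j : Fin n => Set.Ioi (v j)),
        (∫⁻ t in Set.pi Set.univ (fun j : Fin n => Set.Ioi (u j)),
          ENNReal.ofReal (∑' a, Real.exp (-(∑ j, t j * A a j)))) *
        ENNReal.ofReal (∑' b, Real.exp (-(∑ j, u j * A b j)))
      = ∑' p : ι × ι, ENNReal.ofReal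
            ((∏ j, A p.1 j)⁻¹ * ((∏ j, (A p.1 j + A p.2 j)) ^ 2)⁻¹) := by
  have hofr : ∀ t : Fin n → ℝ, (∀ j, 0 < t j) →
      ENNReal.ofReal (∑' a, Real.exp (-(∑ j, t j * A a j))) =
        ∑' a, ENNReal.ofReal (Real.exp (-(∑ j, t j * A a j))) := fun t ht =>
    ENNReal.ofReal_tsum_of_nonneg (fun _ => (Real.exp_pos _).le) (hs t ht)
  have step1 : ∀ u : Fin n → ℝ, (∀ j, 0 < u j) →
      (∫⁻ t in Set.pi Set.univ (fun j : Fin n => Set.Ioi (u j)),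
          ENNReal.ofReal (∑' a, Real.exp (-(∑ j, t j * A a j)))) *
        ENNReal.ofReal (∑' b, Real.exp (-(∑ j, u j * A b j))) =
      ∑' p : ι × ι, ENNReal.ofReal ((∏ j, A p.1 j)⁻¹) *
        ENNReal.ofReal (Real.exp (-(∑ j, u j * (A p.1 j + A p.2 j)))) := by
    intro u hu
    rw [setLIntegral_congr_fun (meas_pi u) (g := fun t =>
      ∑' a, ENNReal.ofReal (Real.exp (-(∑ j, t j * A a j))))
      (fun t ht => hofr t (fun j => (hu j).trans (ht j trivial))),
      lintegral_tsum (fun a => (meas_exp (A a)).aemeasurable), hofr u hu, tsum_mul_tsum']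
    refine tsum_congr (fun p => ?_)
    rw [lint_exp _ _ (hA p.1), mul_assoc, ← ENNReal.ofReal_mul (Real.exp_pos _).le, ← Real.exp_add]
    congr 3
    simp only [mul_add, Finset.sum_add_distrib]
    ring
  have step2 : ∀ v : Fin n → ℝ, (∀ j, 0 < v j) →
      (∫⁻ u in Set.pi Set.univ (fun j : Fin n => Set.Ioi (v j)),
        (∫⁻ t in Set.pi Set.univ (fun j : Fin n => Set.Ioi (u j)),
          ENNReal.ofReal (∑' a, Real.exp (-(∑ j, t j * A a j)))) *
        ENNReal.ofReal (∑' b, Real.exp (-(∑ j, u j * A b j)))) =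
      ∑' p : ι × ι, ENNReal.ofReal ((∏ j, A p.1 j)⁻¹) *
        (ENNReal.ofReal ((∏ j, (A p.1 j + A p.2 j))⁻¹) *
        ENNReal.ofReal (Real.exp (-(∑ j, v j * (A p.1 j + A p.2 j))))) := by
    intro v hv
    rw [setLIntegral_congr_fun (meas_pi v)
      (fun u hu => step1 u (fun j => (hv j).trans (hu j trivial))),
      lintegral_tsum (fun p => ((meas_exp _).const_mul _).aemeasurable)]
    refine tsum_congr (fun p => ?_)
    rw [lintegral_const_mul _ (meas_exp _), lint_exp _ _ (fun j => add_pos (hA p.1 j) (hA p.2 j))]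
  rw [setLIntegral_congr_fun (meas_pi _) (fun v hv => step2 v (fun j => hv j trivial)),
    lintegral_tsum (fun p => (((meas_exp _).const_mul _).const_mul _).aemeasurable)]
  refine tsum_congr (fun p => ?_)
  rw [lintegral_const_mul _ ((meas_exp _).const_mul _), lintegral_const_mul _ (meas_exp _),
    lint_exp _ _ (fun j => add_pos (hA p.1 j) (hA p.2 j))]
  have h1 : 0 ≤ (∏ j, A p.1 j)⁻¹ := inv_nonneg.2 (Finset.prod_nonneg fun j _ => (hA _ j).le)
  have h2 : 0 ≤ (∏ j, (A p.1 j + A p.2 j))⁻¹ :=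
    inv_nonneg.2 (Finset.prod_nonneg fun j _ => (add_pos (hA _ j) (hA _ j)).le)
  simp only [zero_mul, Finset.sum_const_zero, neg_zero, Real.exp_zero, ENNReal.ofReal_one, mul_one]
  rw [← ENNReal.ofReal_mul h2, ← ENNReal.ofReal_mul h1, sq, mul_inv]

lemma exp_summable {n : ℕ} (s : Fin n → ℝ) (hs : ∀ i, 0 < s i) :
    Summable (fun a : Fin n → ℕ => Real.exp (-(∑ i, a i * s i))) := by
  have := summable_pi_prod n (fun i k => Real.exp (-(k * s i))) (fun _ _ => (Real.exp_pos _).le)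
    (fun i => by
      have := Real.summable_exp_nat_mul_iff.2 (neg_lt_zero.2 (hs i))
      simpa using this)
  refine this.congr (fun a => ?_)
  rw [← Real.exp_sum, Finset.sum_neg_distrib]

lemma exists_c {n : ℕ} (E : Fin n → Fin n → ℝ) (hE : ∀ i j, 0 < E i j) :
    ∃ c : ℝ, 0 < c ∧ ∀ i j, c ≤ E i j := by
  obtain h | h := isEmpty_or_nonempty (Fin n × Fin n)
  · exact ⟨1, one_pos, fun i j => (h.false (i, j)).elim⟩
  · obtain ⟨p, hp⟩ := Finite.exists_min (fun p : Fin n × Fin n => E p.1 p.2)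
    exact ⟨_, hE p.1 p.2, fun i j => hp (i, j)⟩

/-- Norm lower bound. -/
lemma norm_lb {n : ℕ} (E : Fin n → Fin n → ℝ) (c : ℝ) (hc : 0 < c) (hE : ∀ i j, c ≤ E i j)
    (x : Fin n → ℝ) (hx : ∀ i, 0 ≤ x i) :
    c ^ n * ∏ i, x i ≤ ∏ j, ∑ i, x i * E i j := by
  have : c ^ n * ∏ i, x i = ∏ i, (c * x i) := by
    rw [Finset.prod_mul_distrib]; simp
  rw [this]
  refine Finset.prod_le_prod (fun i _ => mul_nonneg hc.le (hx i)) (fun j _ => ?_)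
  calc c * x j ≤ x j * E j j := by nlinarith [hx j, hE j j]
    _ ≤ _ := Finset.single_le_sum (f := fun i => x i * E i j)
        (fun i _ => mul_nonneg (hx i) (hc.le.trans (hE i j))) (Finset.mem_univ j)

lemma main_summable {n : ℕ} (E : Fin n → Fin n → ℝ) (hE : ∀ i j, 0 < E i j) :
    Summable (fun p : {a : Fin n → ℕ // ∀ i, 1 ≤ a i} × {a : Fin n → ℕ // ∀ i, 1 ≤ a i} =>
        (∏ j, ∑ i, (p.1.1 i : ℝ) * E i j)⁻¹ *
          ((∏ j, ((∑ i, (p.1.1 i : ℝ) * E i j) + ∑ i, (p.2.1 i : ℝ) * E i j)) ^ 2)⁻¹) := by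
  obtain ⟨c, hc, hcE⟩ := exists_c E hE
  have hS : Summable (fun a : {a : Fin n → ℕ // ∀ i, 1 ≤ a i} =>
      ∏ i, ((a.1 i : ℝ) ^ (3/2 : ℝ))⁻¹) := by
    have := summable_pi_prod n (fun _ k => ((k : ℝ) ^ (3/2 : ℝ))⁻¹) (fun _ _ => by positivity)
      (fun i => Real.summable_nat_rpow_inv.2 (by norm_num))
    exact this.comp_injective Subtype.val_injective
  have hS2 := (hS.mul_of_nonneg hS (fun a => Finset.prod_nonneg (fun i _ => by positivity))
    (fun a => Finset.prod_nonneg (fun i _ => by positivity))).mul_left ((c ^ n) ^ 3)⁻¹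
  have hpos : ∀ a : {a : Fin n → ℕ // ∀ i, 1 ≤ a i}, ∀ i, (0 : ℝ) < a.1 i := fun a i => by
    exact_mod_cast a.2 i
  refine Summable.of_nonneg_of_le (fun p => ?_) (fun p => ?_) hS2
  · refine mul_nonneg (inv_nonneg.2 (Finset.prod_nonneg fun j _ => Finset.sum_nonneg fun i _ =>
      mul_nonneg (hpos _ i).le (hE i j).le)) (inv_nonneg.2 (sq_nonneg _))
  · obtain ⟨a, b⟩ := p
    have ha := hpos a
    have hb := hpos b
    have l1 := norm_lb E c hc hcE (fun i => (a.1 i : ℝ)) (fun i => (ha i).le)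
    have l2 := norm_lb E c hc hcE (fun i => (a.1 i : ℝ) + b.1 i)
      (fun i => (add_pos (ha i) (hb i)).le)
    simp only [add_mul, Finset.sum_add_distrib] at l2
    have pa : 0 < ∏ i, (a.1 i : ℝ) := Finset.prod_pos fun i _ => ha i
    have pab : 0 < ∏ i, ((a.1 i : ℝ) + b.1 i) := Finset.prod_pos fun i _ => add_pos (ha i) (hb i)
    have hcn : 0 < c ^ n := pow_pos hc n
    simp only [Finset.prod_inv_distrib]
    rw [← mul_inv, ← mul_inv, ← mul_inv]
    have key : (∏ i, (a.1 i : ℝ) ^ (3/2 : ℝ)) * (∏ i, (b.1 i : ℝ) ^ (3/2 : ℝ)) ≤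
        (∏ i, (a.1 i : ℝ)) * (∏ i, ((a.1 i : ℝ) + b.1 i)) ^ 2 := by
      rw [← Finset.prod_pow, ← Finset.prod_mul_distrib, ← Finset.prod_mul_distrib]
      refine Finset.prod_le_prod (fun i _ => by positivity) (fun i _ => ?_)
      have e1 : (a.1 i : ℝ) ^ (3/2 : ℝ) = a.1 i * (a.1 i : ℝ) ^ (1/2 : ℝ) := by
        rw [show (3/2 : ℝ) = 1 + 1/2 by norm_num, Real.rpow_add (ha i), Real.rpow_one]
      have e2 : ((a.1 i : ℝ) + b.1 i) ^ 2 =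
          ((a.1 i : ℝ) + b.1 i) ^ (1/2 : ℝ) * ((a.1 i : ℝ) + b.1 i) ^ (3/2 : ℝ) := by
        rw [← Real.rpow_add (add_pos (ha i) (hb i))]
        norm_num
      rw [e1, e2, mul_assoc]
      have := ha i
      have := hb i
      gcongr <;> linarith
    have hprod3 : (0:ℝ) < (∏ i, (a.1 i : ℝ) ^ (3/2 : ℝ)) * (∏ i, (b.1 i : ℝ) ^ (3/2 : ℝ)) :=
      mul_pos (Finset.prod_pos fun i _ => Real.rpow_pos_of_pos (ha i) _)
        (Finset.prod_pos fun i _ => Real.rpow_pos_of_pos (hb i) _)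
    refine inv_anti₀ (by positivity) ?_
    calc _ ≤ (c ^ n) ^ 3 * ((∏ i, (a.1 i : ℝ)) * (∏ i, ((a.1 i : ℝ) + b.1 i)) ^ 2) := by gcongr
      _ = (c ^ n * ∏ i, (a.1 i : ℝ)) * (c ^ n * ∏ i, ((a.1 i : ℝ) + b.1 i)) ^ 2 := by ring
      _ ≤ _ := by
        refine mul_le_mul l1 (pow_le_pow_left₀ (by positivity) l2 2) (by positivity) ?_
        exact (mul_pos hcn pa).le.trans l1

end Z12

/-- ζ_{K;C}(1,2) as an iterated integral on a membrane: for a totally real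
number field `K` of degree `n` with real embeddings `σ j` and totally positive
algebraic integers `e i`, with `α_a = ∑ i, a i • e i` for tuples `a` of positive
integers,
`∫_{v∈(0,∞)ⁿ} ∫_{u∈∏(vⱼ,∞)} (∫_{t∈∏(uⱼ,∞)} ∑_a exp(−∑ⱼ tⱼσⱼ(α_a)) dt)
    · (∑_b exp(−∑ⱼ uⱼσⱼ(α_b))) du dv = ∑_{a,b} N(α_a)⁻¹ N(α_a+α_b)⁻²`,
where the series on the right converges. -/
theorem zeta12_iterated_integral (K : Type*) [Field K] [NumberField K]
    (n : ℕ) (hn : n = Module.finrank ℚ K)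
    (σ : Fin n ≃ (K →+* ℝ))
    (e : Fin n → 𝓞 K)
    (he : ∀ i j, 0 < σ j (e i : K)) :
    Summable
      (fun p : {a : Fin n → ℕ // ∀ i, 1 ≤ a i} × {a : Fin n → ℕ // ∀ i, 1 ≤ a i} =>
        (∏ j, σ j (∑ i, (p.1.1 i : K) * (e i : K)))⁻¹ *
          ((∏ j, σ j ((∑ i, (p.1.1 i : K) * (e i : K)) +
            ∑ i, (p.2.1 i : K) * (e i : K))) ^ 2)⁻¹) ∧
    ∫⁻ v in Set.pi Set.univ (fun _ : Fin n => Set.Ioi (0 : ℝ)),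
      ∫⁻ u in Set.pi Set.univ (fun j : Fin n => Set.Ioi (v j)),
        (∫⁻ t in Set.pi Set.univ (fun j : Fin n => Set.Ioi (u j)),
          ENNReal.ofReal
            (∑' a : {a : Fin n → ℕ // ∀ i, 1 ≤ a i},
              Real.exp (-(∑ j, t j * σ j (∑ i, (a.1 i : K) * (e i : K)))))) *
        ENNReal.ofReal
          (∑' b : {a : Fin n → ℕ // ∀ i, 1 ≤ a i},
            Real.exp (-(∑ j, u j * σ j (∑ i, (b.1 i : K) * (e i : K)))))
      = ENNReal.ofReal
          (∑' p : {a : Fin n → ℕ // ∀ i, 1 ≤ a i} × {a : Fin n → ℕ // ∀ i, 1 ≤ a i},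
            (∏ j, σ j (∑ i, (p.1.1 i : K) * (e i : K)))⁻¹ *
              ((∏ j, σ j ((∑ i, (p.1.1 i : K) * (e i : K)) +
                ∑ i, (p.2.1 i : K) * (e i : K))) ^ 2)⁻¹) := by
  have hn0 : 0 < n := hn ▸ Module.finrank_pos
  haveI : Nonempty (Fin n) := ⟨⟨0, hn0⟩⟩
  have hs := Z12.main_summable (fun i j => σ j (e i : K)) he
  have hpos : ∀ (a : {a : Fin n → ℕ // ∀ i, 1 ≤ a i}) (j : Fin n),
      0 < ∑ i, (a.1 i : ℝ) * σ j (e i : K) := fun a j =>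
    Finset.sum_pos (fun i _ => mul_pos (by exact_mod_cast a.2 i) (he i j)) Finset.univ_nonempty
  simp only [map_add, map_sum, map_mul, map_natCast]
  refine ⟨hs, ?_⟩
  rw [Z12.main_int (fun (a : {a : Fin n → ℕ // ∀ i, 1 ≤ a i}) j =>
    ∑ i, (a.1 i : ℝ) * σ j (e i : K)) hpos ?_, ENNReal.ofReal_tsum_of_nonneg ?_ hs]
  · intro p
    refine mul_nonneg (inv_nonneg.2 (Finset.prod_nonneg fun j _ => (hpos _ j).le))
      (inv_nonneg.2 (sq_nonneg _))
  · intro t ht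
    have h := (Z12.exp_summable (fun i => ∑ j, t j * σ j (e i : K)) (fun i =>
      Finset.sum_pos (fun j _ => mul_pos (ht j) (he i j)) Finset.univ_nonempty)).comp_injective
      (Subtype.val_injective (p := fun a : Fin n → ℕ => ∀ i, 1 ≤ a i))
    refine h.congr (fun a => ?_)
    simp only [Function.comp, Finset.mul_sum]
    rw [Finset.sum_comm]
    congr 2
    refine Finset.sum_congr rfl fun i _ => Finset.sum_congr rfl fun j _ => by ring
end

section
/- Let K be a totally real number field of degree n over ℚ, let σ_1, …, σ_n : K → ℝ be its n real embeddings, and let e_1, …, e_n ∈ O_K satisfy σ_j(e_i) > 0 for all i, j. Let m ≥ 1 and let s_1, …, s_m be positive integers with s_m ≥ 2. For b ∈ ((ℕ≥1)^n)^m write β_k = b_{k,1} e_1 + ⋯ + b_{k,n} e_n and N(α) = ∏_{j} σ_j(α). Then the family indexed by b of ∏_{k=1}^{m} N(β_1 + ⋯ + β_k)^{−s_k} is summable; that is, the multiple Dedekind zeta value ζ_{K;C}(s_1,…,s_m) = ∑_{β_1,…,β_m ∈ C} N(β_1)^{−s_1} N(β_1+β_2)^{−s_2} ⋯ N(β_1+⋯+β_m)^{−s_m}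 converges. -/
open scoped NumberField

lemma aux_summable_pi {α : Type*} (g : α → ℝ) (hg : Summable g) (h0 : ∀ a, 0 ≤ g a) (m : ℕ) :
    Summable (fun b : Fin m → α => ∏ k, g (b k)) := by
  induction m with
  | zero => exact Summable.of_finite
  | succ m ih =>
    have h := Summable.mul_of_nonneg hg ih h0 (fun b => Finset.prod_nonneg fun k _ => h0 (b k))
    rw [← (Fin.consEquiv (fun _ : Fin (m+1) => α)).summable_iff]
    refine h.congr ?_
    intro x
    simp [Fin.prod_univ_succ, Fin.consEquiv]

lemma aux_ineq (m : ℕ) (L : Fin m) (P M : Fin m → ℝ) (s : Fin m → ℕ)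
    (hP : ∀ k, 1 ≤ P k) (hPM : ∀ k, P k ≤ M k) (hML : ∀ k, M k ≤ M L)
    (hs : ∀ k, 1 ≤ s k) (hL : 2 ≤ s L) :
    ∏ k, (P k) ^ (1 + 1 / (m:ℝ)) ≤ ∏ k, (M k) ^ (s k) := by
  have hM : ∀ k, 1 ≤ M k := fun k => (hP k).trans (hPM k)
  have hM0 : ∀ k, 0 < M k := fun k => by linarith [hM k]
  have hm : (m:ℝ) ≠ 0 := by
    have := L.pos
    positivity
  calc ∏ k, (P k) ^ (1 + 1 / (m:ℝ)) ≤ ∏ k, (M k * (M L) ^ (1 / (m:ℝ))) := by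
        refine Finset.prod_le_prod (fun k _ => ?_) (fun k _ => ?_)
        · have := hP k; positivity
        · have h1 := hP k
          have h2 := hPM k
          rw [Real.rpow_add (by linarith), Real.rpow_one]
          have h3 : P k ^ (1 / (m:ℝ)) ≤ M L ^ (1 / (m:ℝ)) :=
            Real.rpow_le_rpow (by linarith) (h2.trans (hML k)) (by positivity)
          have : 0 ≤ P k ^ (1 / (m:ℝ)) := Real.rpow_nonneg (by linarith) _
          exact mul_le_mul h2 h3 this (hM0 k).le
    _ = (∏ k, M k) * M L := by
        rw [Finset.prod_mul_distrib, Finset.prod_const, Finset.card_univ, Fintype.card_fin,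
          ← Real.rpow_natCast, ← Real.rpow_mul (hM0 L).le, one_div, inv_mul_cancel₀ hm,
          Real.rpow_one]
    _ = ∏ k, (M k * if k = L then M k else 1) := by
        rw [Finset.prod_mul_distrib]; simp
    _ ≤ ∏ k, (M k) ^ (s k) := by
        refine Finset.prod_le_prod (fun k _ => ?_) (fun k _ => ?_)
        · have := hM0 k
          split_ifs <;> positivity
        · split_ifs with h
          · subst h
            rw [← pow_two]
            exact pow_le_pow_right₀ (hM k) hL
          · rw [mul_one]
            exact le_self_pow₀ (hM k) (by have := hs k; omega)

lemma aux_base (n : ℕ) (p : ℝ) (hp : 1 < p) :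
    Summable (fun a : {a : Fin n → ℕ // ∀ i, 1 ≤ a i} => ((∏ i, (a.1 i : ℝ)) ^ p)⁻¹) := by
  have h := aux_summable_pi (fun x : ℕ => ((x:ℝ) ^ p)⁻¹) (Real.summable_nat_rpow_inv.2 hp)
    (fun a => by positivity) n
  refine (h.subtype {a | ∀ i, 1 ≤ a i}).congr ?_
  intro a
  simp only [Function.comp]
  rw [← Real.finsetProd_rpow _ _ (fun i _ => by positivity), Finset.prod_inv_distrib]

/-- Convergence of multiple Dedekind zeta values: for a totally real number
field `K` of degree `n` with real embeddings `σ j`, totally positive algebraic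
integers `e i`, positive integers `s 1, …, s m` with `s m ≥ 2`, the family
`∏ k, N(β₁ + ⋯ + β_k)^{-s_k}` indexed by tuples `(β₁,…,β_m)` of cone elements
`β_k = ∑ i, b k i • e i` (with positive integer coefficients) is summable. -/
theorem mdzv_summable (K : Type*) [Field K] [NumberField K]
    (n : ℕ) (hn : n = Module.finrank ℚ K)
    (σ : Fin n ≃ (K →+* ℝ))
    (e : Fin n → 𝓞 K)
    (he : ∀ i j, 0 < σ j (e i : K))
    (m : ℕ) (hm : 1 ≤ m)
    (s : Fin m → ℕ) (hs : ∀ k, 1 ≤ s k) (hsm : 2 ≤ s ⟨m - 1, by omega⟩) :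
    Summable
      (fun b : Fin m → {a : Fin n → ℕ // ∀ i, 1 ≤ a i} =>
        ∏ k : Fin m,
          ((∏ j, σ j (∑ l ∈ Finset.Iic k,
            ∑ i, ((b l).1 i : K) * (e i : K))) ^ (s k))⁻¹) := by
  have hm0 : (0:ℝ) < m := by exact_mod_cast hm
  have key := aux_summable_pi _ (aux_base n (1 + 1 / (m:ℝ)) (by
    have : 0 < 1 / (m:ℝ) := by positivity
    linarith)) (fun a => by positivity) m
  set D : ℝ := ∏ j, σ j (e j : K) with hD
  have hD0 : 0 < D := Finset.prod_pos fun j _ => he j j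
  have key2 := key.mul_left (∏ k, (D ^ (s k))⁻¹)
  have hnn : ∀ (b : Fin m → {a : Fin n → ℕ // ∀ i, 1 ≤ a i}) l j i,
      0 ≤ ((b l).1 i : ℝ) * σ j (e i : K) := fun b l j i =>
    mul_nonneg (by positivity) (he i j).le
  have hmap : ∀ (b : Fin m → {a : Fin n → ℕ // ∀ i, 1 ≤ a i}) k j,
      σ j (∑ l ∈ Finset.Iic k, ∑ i, ((b l).1 i : K) * (e i : K)) =
        ∑ l ∈ Finset.Iic k, ∑ i, ((b l).1 i : ℝ) * σ j (e i : K) := by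
    intro b k j
    simp [map_sum]
  simp only [hmap]
  have hnn2 : ∀ (b : Fin m → {a : Fin n → ℕ // ∀ i, 1 ≤ a i}) k j,
      0 ≤ ∑ l ∈ Finset.Iic k, ∑ i, ((b l).1 i : ℝ) * σ j (e i : K) := fun b k j =>
    Finset.sum_nonneg fun l _ => Finset.sum_nonneg fun i _ => hnn b l j i
  refine Summable.of_nonneg_of_le (fun b => ?_) (fun b => ?_) key2
  · exact Finset.prod_nonneg fun k _ => inv_nonneg.2 (pow_nonneg
      (Finset.prod_nonneg fun j _ => hnn2 b k j) _)
  · set N : Fin m → ℝ := fun k =>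
      ∏ j, ∑ l ∈ Finset.Iic k, ∑ i, ((b l).1 i : ℝ) * σ j (e i : K) with hN
    have hP : ∀ k, 1 ≤ ∏ i, ((b k).1 i : ℝ) := fun k => by
      have : 1 ≤ ∏ i, (b k).1 i := Finset.one_le_prod' fun i _ => (b k).2 i
      exact_mod_cast this
    have hineq := aux_ineq m ⟨m - 1, by omega⟩ (fun k => ∏ i, ((b k).1 i : ℝ))
      (fun k => N k / D) s hP (fun k => by
        rw [le_div_iff₀ hD0, hD, ← Finset.prod_mul_distrib]
        refine Finset.prod_le_prod (fun j _ => hnn b k j j) (fun j _ => ?_)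
        calc _ ≤ ∑ i, ((b k).1 i : ℝ) * σ j (e i : K) :=
              Finset.single_le_sum (f := fun i => ((b k).1 i : ℝ) * σ j (e i : K))
                (fun i _ => hnn b k j i) (Finset.mem_univ j)
          _ ≤ _ := Finset.single_le_sum
                (f := fun l => ∑ i, ((b l).1 i : ℝ) * σ j (e i : K))
                (fun l _ => Finset.sum_nonneg fun i _ => hnn b l j i)
                (Finset.mem_Iic.2 le_rfl)) (fun k => by
        refine div_le_div_of_nonneg_right ?_ hD0.le
        refine Finset.prod_le_prod (fun j _ => hnn2 b k j) (fun j _ => ?_)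
        refine Finset.sum_le_sum_of_subset_of_nonneg (Finset.Iic_subset_Iic.2 ?_)
          (fun l _ _ => Finset.sum_nonneg fun i _ => hnn b l j i)
        rw [Fin.le_def]
        have := k.2
        simp only
        omega) hs hsm
    have hpos : 0 < ∏ k, (∏ i, ((b k).1 i : ℝ)) ^ (1 + 1 / (m:ℝ)) :=
      Finset.prod_pos fun k _ => Real.rpow_pos_of_pos (by linarith [hP k]) _
    have h3 := inv_anti₀ hpos hineq
    have h4 : ∏ k, (N k ^ s k)⁻¹ = (∏ k, (D ^ (s k))⁻¹) * (∏ k, (N k / D) ^ s k)⁻¹ := by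
      rw [← Finset.prod_inv_distrib, ← Finset.prod_mul_distrib]
      refine Finset.prod_congr rfl fun k _ => ?_
      rw [← mul_inv, ← mul_pow, mul_div_cancel₀ _ hD0.ne']
    change ∏ k, (N k ^ s k)⁻¹ ≤ _
    rw [h4, Finset.prod_inv_distrib (f := fun k => (∏ i, ((b k).1 i : ℝ)) ^ (1 + 1 / (m:ℝ)))]
    exact mul_le_mul_of_nonneg_left h3 (Finset.prod_nonneg fun k _ => by positivity)
end

section
/- The integral of the function (x, y) ↦ 1/((1 − x)·y) over the open simplex {(x, y) ∈ ℝ² : 0 < x < y < 1} (with respect to Lebesgue measure on ℝ²) equals ∑_{n=1}^{∞} 1/n², i.e. equals ζ(2) = π²/6. -/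
open MeasureTheory Real

lemma aux_one (n : ℕ) (a c : ℝ) (ha : 0 ≤ a) (hc : 0 ≤ c) :
    ∫⁻ x in Set.Ioo 0 a, ENNReal.ofReal (x ^ n * c) = ENNReal.ofReal (a ^ (n + 1) / (n + 1) * c) := by
  rw [← ofReal_integral_eq_lintegral_ofReal]
  · congr 1
    rw [← integral_Ioc_eq_integral_Ioo, ← intervalIntegral.integral_of_le ha]
    simp
  · exact (Continuous.integrableOn_Icc (by fun_prop)).mono_set Set.Ioo_subset_Icc_self
  · filter_upwards [ae_restrict_mem measurableSet_Ioo] with x hx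
    have := hx.1.le
    simp only [Pi.zero_apply]
    positivity

lemma aux_meas : MeasurableSet {p : ℝ × ℝ | 0 < p.1 ∧ p.1 < p.2 ∧ p.2 < 1} := by
  exact (measurableSet_lt measurable_const measurable_fst).inter
    ((measurableSet_lt measurable_fst measurable_snd).inter
      (measurableSet_lt measurable_snd measurable_const))

lemma aux_two (n : ℕ) :
    ∫⁻ p in {p : ℝ × ℝ | 0 < p.1 ∧ p.1 < p.2 ∧ p.2 < 1}, ENNReal.ofReal (p.1 ^ n * p.2⁻¹)
      = ENNReal.ofReal (1 / ((n : ℝ) + 1) ^ 2) := by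
  have hm : Measurable (fun p : ℝ × ℝ => ENNReal.ofReal (p.1 ^ n * p.2⁻¹)) := by fun_prop
  rw [← lintegral_indicator aux_meas, Measure.volume_eq_prod,
    lintegral_prod_symm' _ (hm.indicator aux_meas)]
  have h1 : ∀ y : ℝ, (∫⁻ x : ℝ, Set.indicator {p : ℝ × ℝ | 0 < p.1 ∧ p.1 < p.2 ∧ p.2 < 1}
      (fun p : ℝ × ℝ => ENNReal.ofReal (p.1 ^ n * p.2⁻¹)) (x, y)) =
      Set.indicator (Set.Ioo 0 1) (fun y : ℝ => ENNReal.ofReal (y ^ n * (1 / ((n : ℝ) + 1)))) y := by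
    intro y
    by_cases hy : y ∈ Set.Ioo (0 : ℝ) 1
    · rw [Set.indicator_of_mem hy]
      have h2 : y ^ n * (1 / ((n : ℝ) + 1)) = y ^ (n + 1) / (n + 1) * y⁻¹ := by
        have := hy.1.ne'
        field_simp
        ring
      rw [h2, ← aux_one n y y⁻¹ hy.1.le (inv_nonneg.2 hy.1.le),
        ← lintegral_indicator measurableSet_Ioo]
      congr 1
      ext x
      simp only [Set.indicator, Set.mem_ofPred_eq, Set.mem_Ioo, hy.2, and_true]
    · rw [Set.indicator_of_notMem hy]
      have : ∀ x : ℝ, Set.indicator {p : ℝ × ℝ | 0 < p.1 ∧ p.1 < p.2 ∧ p.2 < 1}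
          (fun p : ℝ × ℝ => ENNReal.ofReal (p.1 ^ n * p.2⁻¹)) (x, y) = 0 := by
        intro x
        apply Set.indicator_of_notMem
        rintro ⟨h, h', h''⟩
        exact hy ⟨lt_trans h h', h''⟩
      simp [this]
  simp_rw [h1]
  rw [lintegral_indicator measurableSet_Ioo, aux_one n 1 _ zero_le_one (by positivity)]
  congr 1
  field_simp
  simp

lemma aux_sum : HasSum (fun n : ℕ => 1 / ((n : ℝ) + 1) ^ 2) (π ^ 2 / 6) := by
  have := (hasSum_nat_add_iff' (f := fun n : ℕ => (1 : ℝ) / (n : ℝ) ^ 2) 1).2 hasSum_zeta_two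
  simpa using this

lemma aux_pnat : (∑' n : ℕ+, 1 / (n : ℝ) ^ 2) = π ^ 2 / 6 := by
  rw [tsum_pnat_eq_tsum_succ (f := fun n : ℕ => 1 / (n : ℝ) ^ 2), ← aux_sum.tsum_eq]
  simp

/-- `∫_{0<x<y<1} dx dy /((1−x)·y) = ∑_{n≥1} 1/n² = ζ(2) = π²/6`. -/
theorem zeta2_as_simplex_integral :
    (∫ p in {p : ℝ × ℝ | 0 < p.1 ∧ p.1 < p.2 ∧ p.2 < 1},
        1 / ((1 - p.1) * p.2)) = ∑' n : ℕ+, 1 / (n : ℝ) ^ 2 ∧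
      (∑' n : ℕ+, 1 / (n : ℝ) ^ 2) = π ^ 2 / 6 := by
  refine ⟨?_, aux_pnat⟩
  rw [aux_pnat, integral_eq_lintegral_of_nonneg_ae]
  · have h : ∫⁻ p in {p : ℝ × ℝ | 0 < p.1 ∧ p.1 < p.2 ∧ p.2 < 1},
        ENNReal.ofReal (1 / ((1 - p.1) * p.2)) =
        ∫⁻ p in {p : ℝ × ℝ | 0 < p.1 ∧ p.1 < p.2 ∧ p.2 < 1},
        ∑' n : ℕ, ENNReal.ofReal (p.1 ^ n * p.2⁻¹) := by
      refine setLIntegral_congr_fun aux_meas ?_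
      rintro ⟨x, y⟩ ⟨hx, hxy, hy⟩
      simp only at hx hxy hy ⊢
      have hs := (hasSum_geometric_of_lt_one hx.le (hxy.trans hy)).mul_right y⁻¹
      have hy0 := hx.trans hxy
      rw [← ENNReal.ofReal_tsum_of_nonneg (fun n => by positivity) hs.summable, hs.tsum_eq]
      rw [one_div, mul_inv]
    rw [h, lintegral_tsum (fun n => by fun_prop)]
    simp_rw [aux_two]
    rw [← ENNReal.ofReal_tsum_of_nonneg (fun n => by positivity) aux_sum.summable, aux_sum.tsum_eq,
      ENNReal.toReal_ofReal (by positivity)]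
  · filter_upwards [ae_restrict_mem aux_meas] with p hp
    obtain ⟨h, h', h''⟩ := hp
    have h1 : 0 < 1 - p.1 := by linarith
    have h2 : 0 < p.2 := by linarith
    simp only [Pi.zero_apply]
    positivity
  · exact Measurable.aestronglyMeasurable (by fun_prop)
end

section
/- The integral of the function (x, y, z) ↦ 1/((1 − x)·y·z) over the open simplex {(x, y, z) ∈ ℝ³ : 0 < x < y < z < 1} (with respect to Lebesgue measure on ℝ³) equals ∑_{n=1}^{∞} 1/n³, i.e. equals ζ(3). -/
open MeasureTheory

lemma aux_pow (n : ℕ) (y c : ℝ) (hy : 0 ≤ y) (hc : 0 ≤ c) :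
    ∫⁻ x, (Set.Ioo 0 y).indicator (fun x : ℝ => ENNReal.ofReal (c * x ^ n)) x
      = ENNReal.ofReal (c * (y ^ (n + 1) / (n + 1))) := by
  rw [lintegral_indicator measurableSet_Ioo, setLIntegral_congr Ioo_ae_eq_Ioc,
    ← ofReal_integral_eq_lintegral_ofReal]
  · rw [← intervalIntegral.integral_of_le hy, intervalIntegral.integral_const_mul, integral_pow]
    simp
  · rw [← IntegrableOn, ← intervalIntegrable_iff_integrableOn_Ioc_of_le hy]
    exact Continuous.intervalIntegrable (by fun_prop) _ _
  · filter_upwards [ae_restrict_mem measurableSet_Ioc] with x hx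
    have := hx.1.le
    simp only [Pi.zero_apply]
    positivity

def auxS : Set (ℝ × ℝ × ℝ) := {p | 0 < p.1 ∧ p.1 < p.2.1 ∧ p.2.1 < p.2.2 ∧ p.2.2 < 1}
def auxT : Set (ℝ × ℝ) := {p | 0 < p.1 ∧ p.1 < p.2 ∧ p.2 < 1}

lemma auxS_meas : MeasurableSet auxS := by
  have h1 : MeasurableSet {p : ℝ × ℝ × ℝ | 0 < p.1} := measurableSet_lt (by fun_prop) (by fun_prop)
  have h2 : MeasurableSet {p : ℝ × ℝ × ℝ | p.1 < p.2.1} :=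
    measurableSet_lt (by fun_prop) (by fun_prop)
  have h3 : MeasurableSet {p : ℝ × ℝ × ℝ | p.2.1 < p.2.2} :=
    measurableSet_lt (by fun_prop) (by fun_prop)
  have h4 : MeasurableSet {p : ℝ × ℝ × ℝ | p.2.2 < 1} :=
    measurableSet_lt (by fun_prop) (by fun_prop)
  exact h1.inter (h2.inter (h3.inter h4))

lemma auxT_meas : MeasurableSet auxT := by
  have h1 : MeasurableSet {p : ℝ × ℝ | 0 < p.1} := measurableSet_lt (by fun_prop) (by fun_prop)
  have h2 : MeasurableSet {p : ℝ × ℝ | p.1 < p.2} :=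
    measurableSet_lt (by fun_prop) (by fun_prop)
  have h3 : MeasurableSet {p : ℝ × ℝ | p.2 < 1} :=
    measurableSet_lt (by fun_prop) (by fun_prop)
  exact h1.inter (h2.inter h3)

lemma aux_inner (n : ℕ) (q : ℝ × ℝ) :
    ∫⁻ x, auxS.indicator (fun p => ENNReal.ofReal (1 / (p.2.1 * p.2.2) * p.1 ^ n)) (x, q)
      = auxT.indicator (fun q => ENNReal.ofReal (1 / ((n + 1) * q.2) * q.1 ^ n)) q := by
  obtain ⟨y, z⟩ := q
  by_cases h : (y, z) ∈ auxT
  · rw [Set.indicator_of_mem h]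
    obtain ⟨h1, h2, h3⟩ := h
    simp only at h1 h2 h3
    have hz : 0 < z := h1.trans h2
    have := aux_pow n y (1 / (y * z)) h1.le (by positivity)
    convert this using 2
    · ext x
      simp only [Set.indicator, auxS, Set.mem_ofPred_eq, Set.mem_Ioo, h2, h3, and_true]
    · field_simp
      ring
  · rw [Set.indicator_of_notMem h]
    convert lintegral_zero with x
    rw [Set.indicator_of_notMem]
    rintro ⟨h1, h2, h3, h4⟩
    exact h ⟨h1.trans h2, h3, h4⟩

lemma aux_mid (n : ℕ) (z : ℝ) :
    ∫⁻ y, auxT.indicator (fun q => ENNReal.ofReal (1 / ((n + 1) * q.2) * q.1 ^ n)) (y, z)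
      = (Set.Ioo (0:ℝ) 1).indicator (fun z => ENNReal.ofReal (1 / (n + 1) ^ 2 * z ^ n)) z := by
  by_cases h : z ∈ Set.Ioo (0:ℝ) 1
  · rw [Set.indicator_of_mem h]
    obtain ⟨h1, h2⟩ := h
    have := aux_pow n z (1 / ((n + 1) * z)) h1.le (by positivity)
    convert this using 2
    · ext x
      simp only [Set.indicator, auxT, Set.mem_ofPred_eq, Set.mem_Ioo, h2, and_true]
    · field_simp
      ring
  · rw [Set.indicator_of_notMem h]
    convert lintegral_zero with x
    rw [Set.indicator_of_notMem]
    rintro ⟨h1, h2, h3⟩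
    exact h ⟨h1.trans h2, h3⟩

lemma aux_G_meas (n : ℕ) : Measurable
    (auxS.indicator (fun p => ENNReal.ofReal (1 / (p.2.1 * p.2.2) * p.1 ^ n))) :=
  Measurable.indicator (by fun_prop) auxS_meas

lemma aux_term (n : ℕ) :
    ∫⁻ p, auxS.indicator (fun p => ENNReal.ofReal (1 / (p.2.1 * p.2.2) * p.1 ^ n)) p
      = ENNReal.ofReal (1 / ((n : ℝ) + 1) ^ 3) := by
  rw [Measure.volume_eq_prod, lintegral_prod_symm _ (aux_G_meas n).aemeasurable]
  simp_rw [aux_inner]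
  rw [Measure.volume_eq_prod, lintegral_prod_symm _
    (Measurable.indicator (by fun_prop) auxT_meas).aemeasurable]
  simp_rw [aux_mid]
  rw [aux_pow n 1 _ zero_le_one (by positivity)]
  congr 1
  field_simp
  simp

/-- `∫_{0<x<y<z<1} dx dy dz /((1−x)·y·z) = ∑_{n≥1} 1/n³ = ζ(3)`. -/
theorem zeta3_as_simplex_integral :
    (∫ p in {p : ℝ × ℝ × ℝ | 0 < p.1 ∧ p.1 < p.2.1 ∧ p.2.1 < p.2.2 ∧ p.2.2 < 1},
        1 / ((1 - p.1) * p.2.1 * p.2.2)) = ∑' n : ℕ+, 1 / (n : ℝ) ^ 3 := by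
  change (∫ p in auxS, 1 / ((1 - p.1) * p.2.1 * p.2.2)) = _
  rw [integral_eq_lintegral_of_nonneg_ae]
  · have key : ∫⁻ p in auxS, ENNReal.ofReal (1 / ((1 - p.1) * p.2.1 * p.2.2))
        = ∑' n : ℕ, ENNReal.ofReal (1 / ((n : ℝ) + 1) ^ 3) := by
      simp_rw [← aux_term]
      rw [← lintegral_tsum (fun n => (aux_G_meas n).aemeasurable),
        ← lintegral_indicator auxS_meas]
      congr 1
      ext p
      by_cases h : p ∈ auxS
      · simp only [Set.indicator_of_mem h]
        obtain ⟨h1, h2, h3, h4⟩ := h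
        have hy := h1.trans h2
        have hz := hy.trans h3
        have hx : p.1 < 1 := by linarith
        rw [← ENNReal.ofReal_tsum_of_nonneg (fun n => by positivity)
          ((summable_geometric_of_lt_one h1.le hx).mul_left _), tsum_mul_left,
          tsum_geometric_of_lt_one h1.le hx]
        congr 1
        have : 1 - p.1 ≠ 0 := by linarith
        field_simp
      · simp [Set.indicator_of_notMem h]
    have hs : Summable (fun n : ℕ => 1 / ((n : ℝ) + 1) ^ 3) := by
      have := (summable_nat_add_iff 1).2 (Real.summable_one_div_nat_pow.2 (by norm_num : 1 < 3))
      simpa using this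
    rw [key, ← ENNReal.ofReal_tsum_of_nonneg (fun n => by positivity) hs,
      ENNReal.toReal_ofReal (tsum_nonneg fun n => by positivity)]
    rw [tsum_pnat_eq_tsum_succ (f := fun n : ℕ => 1 / (n : ℝ) ^ 3)]
    simp
  · filter_upwards [ae_restrict_mem auxS_meas] with p hp
    obtain ⟨h1, h2, h3, h4⟩ := hp
    have hy := h1.trans h2
    have hz := hy.trans h3
    have hx : 0 < 1 - p.1 := by linarith
    simp only [Pi.zero_apply]
    positivity
  · exact Measurable.aestronglyMeasurable (by fun_prop)
end

section
/- The integral of the function (x, y, z) ↦ 1/((1 − x)·(1 − y)·z) over the open simplex {(x, y, z) ∈ ℝ³ : 0 < x < y < z < 1} (with respect to Lebesgue measure on ℝ³) equals the double zeta value ζ(1,2) = ∑_{0 < n₁ < n₂} 1/(n₁ · n₂²), and in particular this series converges. -/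
open MeasureTheory

namespace Z12

lemma lint_pow (n : ℕ) (t : ℝ) (ht : 0 ≤ t) (c : ℝ) (hc : 0 ≤ c) :
    ∫⁻ x in Set.Ioo 0 t, ENNReal.ofReal (x ^ n * c) = ENNReal.ofReal (t ^ (n + 1) / (n + 1) * c) := by
  rw [← ofReal_integral_eq_lintegral_ofReal]
  · congr 1
    rw [← integral_Ioc_eq_integral_Ioo, ← intervalIntegral.integral_of_le ht]
    simp
  · have : Continuous (fun x : ℝ => x ^ n * c) := by fun_prop
    exact (this.integrableOn_Icc (a := 0) (b := t)).mono_set Set.Ioo_subset_Icc_self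
  · refine (ae_restrict_iff' measurableSet_Ioo).2 (Filter.Eventually.of_forall fun x hx => ?_)
    have := hx.1.le
    simp only [Pi.zero_apply]; positivity

def S : Set (ℝ × ℝ × ℝ) := {p | 0 < p.1 ∧ p.1 < p.2.1 ∧ p.2.1 < p.2.2 ∧ p.2.2 < 1}
def T : Set (ℝ × ℝ) := {p | 0 < p.1 ∧ p.1 < p.2 ∧ p.2 < 1}

lemma mS : MeasurableSet S := by
  have h1 : MeasurableSet {p : ℝ × ℝ × ℝ | 0 < p.1} := measurableSet_lt (by fun_prop) (by fun_prop)
  have h2 : MeasurableSet {p : ℝ × ℝ × ℝ | p.1 < p.2.1} := measurableSet_lt (by fun_prop) (by fun_prop)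
  have h3 : MeasurableSet {p : ℝ × ℝ × ℝ | p.2.1 < p.2.2} := measurableSet_lt (by fun_prop) (by fun_prop)
  have h4 : MeasurableSet {p : ℝ × ℝ × ℝ | p.2.2 < 1} := measurableSet_lt (by fun_prop) (by fun_prop)
  exact h1.inter (h2.inter (h3.inter h4))

lemma mT : MeasurableSet T := by
  have h1 : MeasurableSet {p : ℝ × ℝ | 0 < p.1} := measurableSet_lt (by fun_prop) (by fun_prop)
  have h2 : MeasurableSet {p : ℝ × ℝ | p.1 < p.2} := measurableSet_lt (by fun_prop) (by fun_prop)
  have h3 : MeasurableSet {p : ℝ × ℝ | p.2 < 1} := measurableSet_lt (by fun_prop) (by fun_prop)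
  exact h1.inter (h2.inter h3)

lemma lint_T (m : ℕ) (c : ℝ) (hc : 0 ≤ c) :
    ∫⁻ p in T, ENNReal.ofReal (p.1 ^ m * (c * p.2⁻¹)) =
      ENNReal.ofReal (c / ((m + 1 : ℝ) ^ 2)) := by
  rw [← lintegral_indicator mT, Measure.volume_eq_prod, lintegral_prod_symm]
  · have h : ∀ z : ℝ, (∫⁻ y, T.indicator (fun p => ENNReal.ofReal (p.1 ^ m * (c * p.2⁻¹))) (y, z))
        = (Set.Ioo (0:ℝ) 1).indicator (fun z => ENNReal.ofReal (z ^ m * (c / (m + 1)))) z := by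
      intro z
      by_cases hz : z ∈ Set.Ioo (0:ℝ) 1
      · rw [Set.indicator_of_mem hz]
        have hz0 := hz.1
        have := lint_pow m z hz.1.le (c * z⁻¹) (by positivity)
        rw [← lintegral_indicator measurableSet_Ioo] at this
        trans
        swap
        · refine this.trans ?_
          congr 1
          field_simp
          ring
        · refine lintegral_congr fun y => ?_
          by_cases hy : y ∈ Set.Ioo 0 z
          · rw [Set.indicator_of_mem hy, Set.indicator_of_mem (show (y, z) ∈ T from ⟨hy.1, hy.2, hz.2⟩)]
          · rw [Set.indicator_of_notMem hy, Set.indicator_of_notMem (fun h : (y, z) ∈ T => hy ⟨h.1, h.2.1⟩)]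
      · rw [Set.indicator_of_notMem hz]
        have : ∀ y, T.indicator (fun p => ENNReal.ofReal (p.1 ^ m * (c * p.2⁻¹))) (y, z) = 0 := fun y =>
          Set.indicator_of_notMem (fun h : (y, z) ∈ T => hz ⟨h.1.trans h.2.1, h.2.2⟩) _
        simp [this]
    rw [lintegral_congr h, lintegral_indicator measurableSet_Ioo, lint_pow _ _ zero_le_one _ (by positivity)]
    congr 1
    field_simp
    simp
  · refine (Measurable.indicator ?_ mT).aemeasurable
    fun_prop

lemma lint_S (a b : ℕ) :
    ∫⁻ p in S, ENNReal.ofReal (p.1 ^ a * (p.2.1 ^ b * p.2.2⁻¹)) =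
      ENNReal.ofReal (1 / ((a + 1 : ℝ) * (a + b + 2 : ℝ) ^ 2)) := by
  rw [← lintegral_indicator mS, Measure.volume_eq_prod, lintegral_prod_symm]
  · have h : ∀ q : ℝ × ℝ, (∫⁻ x, S.indicator (fun p => ENNReal.ofReal (p.1 ^ a * (p.2.1 ^ b * p.2.2⁻¹))) (x, q))
        = T.indicator (fun q => ENNReal.ofReal (q.1 ^ (a + b + 1) * ((1 / (a + 1)) * q.2⁻¹))) q := by
      rintro ⟨y, z⟩
      by_cases hz : (y, z) ∈ T
      · rw [Set.indicator_of_mem hz]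
        have hy0 : 0 < y := hz.1
        have hz0 : 0 < z := hz.1.trans hz.2.1
        have := lint_pow a y hy0.le (y ^ b * z⁻¹) (by positivity)
        rw [← lintegral_indicator measurableSet_Ioo] at this
        trans
        swap
        · refine this.trans ?_
          congr 1
          simp only
          field_simp
          ring
        · refine lintegral_congr fun x => ?_
          by_cases hy : x ∈ Set.Ioo 0 y
          · rw [Set.indicator_of_mem hy, Set.indicator_of_mem (show (x, y, z) ∈ S from ⟨hy.1, hy.2, hz.2⟩)]
          · rw [Set.indicator_of_notMem hy, Set.indicator_of_notMem (fun h : (x, y, z) ∈ S => hy ⟨h.1, h.2.1⟩)]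
      · rw [Set.indicator_of_notMem hz]
        have : ∀ x, S.indicator (fun p => ENNReal.ofReal (p.1 ^ a * (p.2.1 ^ b * p.2.2⁻¹))) (x, y, z) = 0 := fun x =>
          Set.indicator_of_notMem (fun h : (x, y, z) ∈ S => hz ⟨h.1.trans h.2.1, h.2.2⟩) _
        simp [this]
    rw [lintegral_congr h, lintegral_indicator mT, lint_T _ _ (by positivity)]
    congr 1
    push_cast
    rw [div_div]
    congr 3
    ring
  · refine (Measurable.indicator ?_ mS).aemeasurable
    fun_prop

def e : ℕ × ℕ ≃ {p : ℕ × ℕ // 0 < p.1 ∧ p.1 < p.2} where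
  toFun q := ⟨(q.1 + 1, q.1 + q.2 + 2), Nat.succ_pos _, by show q.1 + 1 < q.1 + q.2 + 2; omega⟩
  invFun p := (p.1.1 - 1, p.1.2 - p.1.1 - 1)
  left_inv := by rintro ⟨a, b⟩; simp only [Prod.mk.injEq]; omega
  right_inv := by
    rintro ⟨⟨a, b⟩, h1, h2⟩
    simp only at h1 h2
    simp only [Subtype.mk.injEq, Prod.mk.injEq]
    omega

lemma summ : Summable (fun q : ℕ × ℕ => 1 / ((q.1 + 1 : ℝ) * (q.1 + q.2 + 2 : ℝ) ^ 2)) := by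
  have h1 : Summable (fun n : ℕ => 1 / ((n + 1 : ℝ) ^ (3 / 2 : ℝ))) := by
    have := (summable_nat_add_iff 1).2 (Real.summable_one_div_nat_rpow (p := 3 / 2).2 (by norm_num))
    simpa using this
  have h2 := h1.mul_of_nonneg h1 (fun n => by positivity) (fun n => by positivity)
  refine Summable.of_nonneg_of_le (fun q => by positivity) (fun q => ?_) h2
  obtain ⟨a, b⟩ := q
  simp only
  rw [div_mul_div_comm, one_mul]
  apply one_div_le_one_div_of_le (by positivity)
  have ha : (0:ℝ) < a + 1 := by positivity
  have hn : (0:ℝ) < a + b + 2 := by positivity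
  have e1 : (a + 1 : ℝ) ^ (3 / 2 : ℝ) = (a + 1) * (a + 1 : ℝ) ^ (1 / 2 : ℝ) := by
    rw [show (3 / 2 : ℝ) = 1 + 1 / 2 by norm_num, Real.rpow_add ha, Real.rpow_one]
  have e2 : (a + b + 2 : ℝ) ^ 2 = (a + b + 2 : ℝ) ^ (1 / 2 : ℝ) * (a + b + 2 : ℝ) ^ (3 / 2 : ℝ) := by
    rw [← Real.rpow_add hn, ← Real.rpow_natCast]; norm_num
  rw [e1, e2, mul_assoc]
  have i1 : (0:ℝ) ≤ b := by positivity
  have i2 : (0:ℝ) ≤ a := by positivity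
  have i3 : (a + 1 : ℝ) ≤ a + b + 2 := by linarith
  have i4 : (b + 1 : ℝ) ≤ a + b + 2 := by linarith
  have i5 := Real.rpow_le_rpow ha.le i3 (show (0:ℝ) ≤ 1 / 2 by norm_num)
  have i6 := Real.rpow_le_rpow (by positivity) i4 (show (0:ℝ) ≤ 3 / 2 by norm_num)
  exact mul_le_mul_of_nonneg_left (mul_le_mul i5 i6 (by positivity) (by positivity)) ha.le

lemma geom (x y z : ℝ) (h : (x, y, z) ∈ S) :
    ENNReal.ofReal (1 / ((1 - x) * (1 - y) * z)) =
      ∑' q : ℕ × ℕ, ENNReal.ofReal (x ^ q.1 * (y ^ q.2 * z⁻¹)) := by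
  obtain ⟨h1, h2, h3, h4⟩ := h
  simp only at h1 h2 h3 h4
  have hx := hasSum_geometric_of_lt_one h1.le (by linarith)
  have hy := (hasSum_geometric_of_lt_one (h1.trans h2).le (by linarith)).mul_right z⁻¹
  have hy0 : 0 < y := by linarith
  have hz0 : 0 < z := by linarith
  have hs := hx.summable.mul_of_nonneg hy.summable (fun n => by positivity)
    (fun n => by simp only [Pi.zero_apply]; positivity)
  have := hx.mul hy hs
  rw [← ENNReal.ofReal_tsum_of_nonneg (fun q => by positivity) hs, this.tsum_eq]
  congr 1
  rw [one_div, mul_inv, mul_inv, mul_assoc]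

end Z12

open Z12 in
/-- `∫_{0<x<y<z<1} dx dy dz /((1−x)·(1−y)·z) = ζ(1,2) = ∑_{0<n₁<n₂} 1/(n₁·n₂²)`,
and in particular the double series converges. -/
theorem zeta12_as_simplex_integral :
    Summable (fun p : {p : ℕ × ℕ // 0 < p.1 ∧ p.1 < p.2} =>
        1 / ((p.1.1 : ℝ) * (p.1.2 : ℝ) ^ 2)) ∧
    (∫ p in {p : ℝ × ℝ × ℝ | 0 < p.1 ∧ p.1 < p.2.1 ∧ p.2.1 < p.2.2 ∧ p.2.2 < 1},
        1 / ((1 - p.1) * (1 - p.2.1) * p.2.2)) =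
      ∑' p : {p : ℕ × ℕ // 0 < p.1 ∧ p.1 < p.2},
        1 / ((p.1.1 : ℝ) * (p.1.2 : ℝ) ^ 2) := by
  have he : ∀ q : ℕ × ℕ, 1 / (((e q).1.1 : ℝ) * ((e q).1.2 : ℝ) ^ 2) =
      1 / ((q.1 + 1 : ℝ) * (q.1 + q.2 + 2 : ℝ) ^ 2) := by
    intro q; simp [e]
  constructor
  · rw [← e.summable_iff]
    exact summ.congr fun q => (he q).symm
  · rw [← e.tsum_eq, tsum_congr he]
    change ∫ p in S, _ = _
    rw [integral_eq_lintegral_of_nonneg_ae]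
    · rw [setLIntegral_congr_fun mS (fun p hp => geom p.1 p.2.1 p.2.2 hp), lintegral_tsum]
      · simp_rw [lint_S]
        rw [← ENNReal.ofReal_tsum_of_nonneg (fun q => by positivity) summ, ENNReal.toReal_ofReal]
        exact tsum_nonneg fun q => by positivity
      · intro q
        have : Measurable fun p : ℝ × ℝ × ℝ => ENNReal.ofReal (p.1 ^ q.1 * (p.2.1 ^ q.2 * p.2.2⁻¹)) := by
          fun_prop
        exact this.aemeasurable
    · refine (ae_restrict_iff' mS).2 (Filter.Eventually.of_forall fun p hp => ?_)
      obtain ⟨h1, h2, h3, h4⟩ := hp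
      have i1 : 0 < 1 - p.1 := by linarith
      have i2 : 0 < 1 - p.2.1 := by linarith
      have i3 : 0 < p.2.2 := by linarith
      simp only [Pi.zero_apply]; positivity
    · have : Measurable fun p : ℝ × ℝ × ℝ => 1 / ((1 - p.1) * (1 - p.2.1) * p.2.2) := by
        fun_prop
      exact this.aestronglyMeasurable
end
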